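/- Let H be an infinite-dimensional complex Hilbert space (X = B(H)), λ > 1, 1 ≤ p < ∞ and 1 ≤ q ≤ ∞. There exist constants E₅ > 0 and E₆ > 0 independent of X and n such that for every n ∈ ℕ: (lower bounds) if p > min{Cot(X),q}, then AP_λ(B_{ℓ^n_q},p,X) ≥ E₅ · λ^{−1}(λ^p−1)^{1/p} · n^{−1/q}; and if p ≤ min{Cot(X),q} and X has finite cotype t, then AP_λ(B_{ℓ^n_q},p,X) ≥ E₆ · λ^{−1}(λ^p−1)^{1/p} · n^{1/min{t,q} − 1/p − 1/q}; (upper bounds) if q ≤ Cot(X), then AP_λ(B_{ℓ^n_q},p,X) ≤ 2^{1−1/p} λ n^{−1/p}, and if q > Cot(X), then AP_λ(B_{ℓ^n_q},p,X) ≤ 2^{1−1/p} λ n^{1/Cot(X) − 1/p − 1/q}. -/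

import Mathlib

open scoped BigOperators ENNReal NNReal Pointwise
open Finset

noncomputable section

namespace ArithBohr

/-- The monomial `z ^ α` on `ℂ^n`. -/
def mono {n : ℕ} (z : Fin n → ℂ) (α : Fin n → ℕ) : ℂ := ∏ i, z i ^ α i

/-- The real monomial `r ^ α`. -/
def monoR {n : ℕ} (r : Fin n → ℝ) (α : Fin n → ℕ) : ℝ := ∏ i, r i ^ α i

/-- `‖f‖_Ω = sup_{z ∈ Ω} ‖f z‖`. -/
def supNorm {n : ℕ} {E : Type*} [Norm E] (Ω : Set (Fin n → ℂ)) (f : (Fin n → ℂ) → E) : ℝ :=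
  ⨆ z : Ω, ‖f z.1‖

/-- `f` is bounded on `Ω`. -/
def IsBoundedOn {n : ℕ} {E : Type*} [Norm E] (Ω : Set (Fin n → ℂ)) (f : (Fin n → ℂ) → E) :
    Prop :=
  ∃ M : ℝ, ∀ z ∈ Ω, ‖f z‖ ≤ M

/-- A complete Reinhardt set in `ℂ^n`. -/
def IsCompleteReinhardt {n : ℕ} (Ω : Set (Fin n → ℂ)) : Prop :=
  ∀ z ∈ Ω, ∀ ξ : Fin n → ℂ, (∀ i, ‖ξ i‖ ≤ 1) → (fun i => ξ i * z i) ∈ Ω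

/-- The `ℓ_q` norm on `ℂ^n`, `q ∈ [1,∞]` (as an extended real exponent). -/
def lqNorm {n : ℕ} (q : ℝ≥0∞) (z : Fin n → ℂ) : ℝ :=
  if q = ∞ then ⨆ i, ‖z i‖ else (∑ i, ‖z i‖ ^ q.toReal) ^ (1 / q.toReal)

/-- The `ℓ_q` norm on `ℂ^n` for a real exponent `1 ≤ q < ∞`. -/
def lqNormR {n : ℕ} (q : ℝ) (z : Fin n → ℂ) : ℝ := (∑ i, ‖z i‖ ^ q) ^ (1 / q)

/-- The open unit ball of `ℓ^n_q`. -/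
def lqBall (n : ℕ) (q : ℝ≥0∞) : Set (Fin n → ℂ) := {z | lqNorm q z < 1}

/-- The open unit ball of `ℓ^n_q` for a real exponent. -/
def lqBallR (n : ℕ) (q : ℝ) : Set (Fin n → ℂ) := {z | lqNormR q z < 1}

/-- The open unit ball of `ℓ^n_1`. -/
def l1Ball (n : ℕ) : Set (Fin n → ℂ) := {z | ∑ i, ‖z i‖ < 1}

/-- `S(Ω₁, Ω₂) = inf {s > 0 : Ω₁ ⊆ s Ω₂}`. -/
def Sdist {n : ℕ} (Ω₁ Ω₂ : Set (Fin n → ℂ)) : ℝ := sInf {s : ℝ | 0 < s ∧ Ω₁ ⊆ s • Ω₂}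

/-- A norm on `ℂ^n` for which the canonical basis is `1`-unconditional. -/
structure UncondNorm (n : ℕ) where
  N : (Fin n → ℂ) → ℝ
  eq_zero_iff : ∀ z, N z = 0 ↔ z = 0
  add_le : ∀ z w, N (z + w) ≤ N z + N w
  smul_eq : ∀ (c : ℂ) (z), N (c • z) = ‖c‖ * N z
  uncond : ∀ ξ z : Fin n → ℂ, (∀ i, ‖ξ i‖ ≤ 1) → N (fun i => ξ i * z i) ≤ N z

namespace UncondNorm

variable {n : ℕ} (Z : UncondNorm n)

/-- The open unit ball `B_Z`. -/
def ball : Set (Fin n → ℂ) := {z | Z.N z < 1}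

/-- `‖Id : Z → ℓ^n_q‖ = sup_{z ∈ B_Z} ‖z‖_q`. -/
def toLq (q : ℝ≥0∞) : ℝ := ⨆ z : Z.ball, lqNorm q z.1

/-- `‖Id : ℓ^n_q → Z‖ = sup_{‖z‖_q ≤ 1} ‖z‖_Z`. -/
def fromLq (q : ℝ≥0∞) : ℝ := ⨆ z : {w : Fin n → ℂ | lqNorm q w ≤ 1}, Z.N z.1

/-- `‖Id : Z → ℓ^n_1‖ = sup_{z ∈ B_Z} Σ_i |z_i|`. -/
def toL1 : ℝ := ⨆ z : Z.ball, ∑ i, ‖z.1 i‖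

/-- `‖Id : ℓ^n_2 → Z‖`. -/
def fromL2 : ℝ := ⨆ z : {w : Fin n → ℂ | Real.sqrt (∑ i, ‖w i‖ ^ 2) ≤ 1}, Z.N z.1

/-- `sup_{z ∈ B_Z} ‖z‖_p` for a real exponent `p`. -/
def supLp (p : ℝ) : ℝ := ⨆ z : Z.ball, lqNormR p z.1

end UncondNorm

section Pluriharmonic

variable {n : ℕ} {H : Type*} [NormedAddCommGroup H] [InnerProductSpace ℂ H] [CompleteSpace H]
variable {Y : Type*} [NormedAddCommGroup Y] [NormedSpace ℂ Y]

/-- `f : Ω → B(H)` is (representable as) a pluriharmonic function with coefficient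
families `a`, `b`:  `f z = Σ_α a_α z^α + Σ_{|α| ≥ 1} b_α^* z̄^α` on `Ω`. -/
def Represents (Ω : Set (Fin n → ℂ)) (f : (Fin n → ℂ) → (H →L[ℂ] H))
    (a b : (Fin n → ℕ) → (H →L[ℂ] H)) : Prop :=
  b 0 = 0 ∧ ∀ z ∈ Ω,
    Summable (fun α => mono z α • a α) ∧
    Summable (fun α => mono (star z) α • (ContinuousLinearMap.adjoint (b α))) ∧
    f z = (∑' α, mono z α • a α) +
      ∑' α, mono (star z) α • (ContinuousLinearMap.adjoint (b α))

/-- The class `PH(Ω, B(H))` of bounded pluriharmonic functions (with their coefficients). -/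
def ClsPH (Ω : Set (Fin n → ℂ)) (f : (Fin n → ℂ) → (H →L[ℂ] H))
    (a b : (Fin n → ℕ) → (H →L[ℂ] H)) : Prop :=
  Represents Ω f a b ∧ IsBoundedOn Ω f

/-- The class `PH(^mΩ, B(H))` of `m`-homogeneous pluriharmonic polynomials. -/
def ClsHomog (Ω : Set (Fin n → ℂ)) (m : ℕ) (f : (Fin n → ℂ) → (H →L[ℂ] H))
    (a b : (Fin n → ℕ) → (H →L[ℂ] H)) : Prop :=
  ClsPH Ω f a b ∧ ∀ α : Fin n → ℕ, (∑ i, α i) ≠ m → a α = 0 ∧ b α = 0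

/-- The class `∪_{m ≥ 1} PH(^mΩ, B(H))`. -/
def ClsHomogUnion (Ω : Set (Fin n → ℂ)) (f : (Fin n → ℂ) → (H →L[ℂ] H))
    (a b : (Fin n → ℕ) → (H →L[ℂ] H)) : Prop :=
  ∃ m : ℕ, 1 ≤ m ∧ ClsHomog Ω m f a b

/-- The class `PH*(Ω, B(H))` of bounded pluriharmonic `f` with `f(0) = μ I`,
`μ ∈ [0, ‖f‖_Ω]`. -/
def ClsPHStar (Ω : Set (Fin n → ℂ)) (f : (Fin n → ℂ) → (H →L[ℂ] H))
    (a b : (Fin n → ℕ) → (H →L[ℂ] H)) : Prop :=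
  ClsPH Ω f a b ∧ ∃ μ : ℝ, 0 ≤ μ ∧ μ ≤ supNorm Ω f ∧ f 0 = (μ : ℂ) • (1 : H →L[ℂ] H)

/-- The vector `r ∈ ℝ^n_{≥0}` witnesses the arithmetic Bohr inequality for the class `Cls`:
`Σ_α (‖U a_α‖^p + ‖U b_α‖^p) r^{pα} ≤ λ^p ‖f‖_Ω^p` for every `f` in the class. -/
def GoodVec (Ω : Set (Fin n → ℂ)) (p lam : ℝ) (U : (H →L[ℂ] H) →L[ℂ] Y)
    (Cls : ((Fin n → ℂ) → (H →L[ℂ] H)) → ((Fin n → ℕ) → (H →L[ℂ] H)) →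
      ((Fin n → ℕ) → (H →L[ℂ] H)) → Prop) (r : Fin n → ℝ) : Prop :=
  ∀ f a b, Cls f a b → ∀ F : Finset (Fin n → ℕ),
    ∑ α ∈ F, (‖U (a α)‖ ^ p + ‖U (b α)‖ ^ p) * monoR r α ^ p ≤ lam ^ p * supNorm Ω f ^ p

/-- The `λ_p`-arithmetic Bohr radius of `Ω` with respect to a class of pluriharmonic
functions. -/
def APgen (Ω : Set (Fin n → ℂ)) (p lam : ℝ) (U : (H →L[ℂ] H) →L[ℂ] Y)
    (Cls : ((Fin n → ℂ) → (H →L[ℂ] H)) → ((Fin n → ℕ) → (H →L[ℂ] H)) →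
      ((Fin n → ℕ) → (H →L[ℂ] H)) → Prop) : ℝ :=
  sSup {t : ℝ | ∃ r : Fin n → ℝ, (∀ i, 0 ≤ r i) ∧ GoodVec Ω p lam U Cls r ∧
    t = (∑ i, r i) / n}

/-- The `λ_p`-arithmetic Bohr radius `AP_λ(Ω, p, U)`. -/
def APradius (Ω : Set (Fin n → ℂ)) (p lam : ℝ) (U : (H →L[ℂ] H) →L[ℂ] Y) : ℝ :=
  APgen Ω p lam U (ClsPH Ω)

/-- The `λ`-powered Bohr radius `R_λ(Ω, p, U)`. -/
def BohrRadius (Ω : Set (Fin n → ℂ)) (p lam : ℝ) (U : (H →L[ℂ] H) →L[ℂ] Y) : ℝ :=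
  sSup {r : ℝ | 0 ≤ r ∧ ∀ f a b, ClsPH Ω f a b → ∀ z ∈ Ω, ∀ F : Finset (Fin n → ℕ),
    ∑ α ∈ F, (‖U (a α)‖ ^ p + ‖U (b α)‖ ^ p) * ‖mono (r • z) α‖ ^ p
      ≤ lam ^ p * supNorm Ω f ^ p}

/-- `sup_{|z| < 1} ‖f z‖`. -/
def supNormDisk {E : Type*} [Norm E] (f : ℂ → E) : ℝ := ⨆ z : {w : ℂ // ‖w‖ < 1}, ‖f z.1‖

/-- `f` is bounded on the unit disk. -/
def IsBoundedOnDisk {E : Type*} [Norm E] (f : ℂ → E) : Prop :=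
  ∃ M : ℝ, ∀ z : ℂ, ‖z‖ < 1 → ‖f z‖ ≤ M

/-- `f : 𝔻 → B(H)` is pluriharmonic with coefficients `a`, `b`:
`f z = Σ_m a_m z^m + Σ_{m ≥ 1} b_m^* z̄^m`. -/
def RepresentsDisk (f : ℂ → (H →L[ℂ] H)) (a b : ℕ → (H →L[ℂ] H)) : Prop :=
  b 0 = 0 ∧ ∀ z : ℂ, ‖z‖ < 1 →
    Summable (fun m => z ^ m • a m) ∧
    Summable (fun m => (starRingEnd ℂ z) ^ m • (ContinuousLinearMap.adjoint (b m))) ∧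
    f z = (∑' m, z ^ m • a m) +
      ∑' m, (starRingEnd ℂ z) ^ m • (ContinuousLinearMap.adjoint (b m))

/-- The one-dimensional `λ`-powered Bohr radius `R_λ(𝔻, p, U)`. -/
def BohrRadiusDisk (p lam : ℝ) (U : (H →L[ℂ] H) →L[ℂ] Y) : ℝ :=
  sSup {r : ℝ | 0 ≤ r ∧ ∀ f a b, RepresentsDisk f a b → IsBoundedOnDisk f →
    ∀ F : Finset ℕ, ∑ m ∈ F, (‖U (a m)‖ ^ p + ‖U (b m)‖ ^ p) * r ^ ((m : ℝ) * p)
      ≤ lam ^ p * supNormDisk f ^ p}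

end Pluriharmonic

section Scalar

variable {n : ℕ}

/-- A complex-valued harmonic function on the unit disk, via its representation
`f z = Σ_m a_m z^m + conj (Σ_{m ≥ 1} b_m z^m)`. -/
def RepresentsDiskC (f : ℂ → ℂ) (a b : ℕ → ℂ) : Prop :=
  b 0 = 0 ∧ ∀ z : ℂ, ‖z‖ < 1 →
    Summable (fun m => a m * z ^ m) ∧ Summable (fun m => b m * z ^ m) ∧
    f z = (∑' m, a m * z ^ m) + starRingEnd ℂ (∑' m, b m * z ^ m)

/-- The scalar one-dimensional Bohr radius `R_λ(𝔻, 1, ℂ)` for harmonic functions. -/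
def BohrRadiusDiskC (lam : ℝ) : ℝ :=
  sSup {r : ℝ | 0 ≤ r ∧ ∀ f a b, RepresentsDiskC f a b → IsBoundedOnDisk f →
    ∀ F : Finset ℕ, ∑ m ∈ F, (‖a m‖ + ‖b m‖) * r ^ m ≤ lam * supNormDisk f}

/-- A complex-valued pluriharmonic function on `Ω ⊆ ℂ^n`, via its representation
`f z = Σ_α a_α z^α + conj (Σ_{|α| ≥ 1} b_α z^α)`. -/
def RepresentsC (Ω : Set (Fin n → ℂ)) (f : (Fin n → ℂ) → ℂ) (a b : (Fin n → ℕ) → ℂ) :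
    Prop :=
  b 0 = 0 ∧ ∀ z ∈ Ω,
    Summable (fun α => a α * mono z α) ∧ Summable (fun α => b α * mono z α) ∧
    f z = (∑' α, a α * mono z α) + starRingEnd ℂ (∑' α, b α * mono z α)

/-- The scalar arithmetic Bohr radius `AP_λ(Ω, 1, ℂ)` for pluriharmonic functions. -/
def APradiusC (Ω : Set (Fin n → ℂ)) (lam : ℝ) : ℝ :=
  sSup {t : ℝ | ∃ r : Fin n → ℝ, (∀ i, 0 ≤ r i) ∧
    (∀ f a b, RepresentsC Ω f a b → IsBoundedOn Ω f →
      ∀ F : Finset (Fin n → ℕ), ∑ α ∈ F, (‖a α‖ + ‖b α‖) * monoR r α ≤ lam * supNorm Ω f) ∧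
    t = (∑ i, r i) / n}

end Scalar

section Holomorphic

variable {n : ℕ} {X : Type*} [NormedAddCommGroup X] [NormedSpace ℂ X]
variable {Y : Type*} [NormedAddCommGroup Y] [NormedSpace ℂ Y]

/-- `f : Ω → X` has the monomial expansion `f z = Σ_α a_α z^α` on `Ω`. -/
def RepresentsHol (Ω : Set (Fin n → ℂ)) (f : (Fin n → ℂ) → X)
    (a : (Fin n → ℕ) → X) : Prop :=
  ∀ z ∈ Ω, HasSum (fun α => mono z α • a α) (f z)

/-- The `λ`-powered Bohr radius `K_λ(Ω, p, U)` for holomorphic functions. -/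
def Kradius (Ω : Set (Fin n → ℂ)) (p lam : ℝ) (U : X →L[ℂ] Y) : ℝ :=
  sSup {r : ℝ | 0 ≤ r ∧ ∀ f a, RepresentsHol Ω f a → IsBoundedOn Ω f →
    ∀ z ∈ Ω, ∀ F : Finset (Fin n → ℕ),
      ∑ α ∈ F, ‖mono (r • z) α • U (a α)‖ ^ p ≤ lam ^ p * supNorm Ω f ^ p}

/-- The `λ_p`-arithmetic Bohr radius `A_λ(Ω, p, U)` for holomorphic functions. -/
def Aradius (Ω : Set (Fin n → ℂ)) (p lam : ℝ) (U : X →L[ℂ] Y) : ℝ :=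
  sSup {t : ℝ | ∃ r : Fin n → ℝ, (∀ i, 0 ≤ r i) ∧
    (∀ f a, RepresentsHol Ω f a → IsBoundedOn Ω f →
      ∀ F : Finset (Fin n → ℕ),
        ∑ α ∈ F, ‖U (a α)‖ ^ p * monoR r α ^ p ≤ lam ^ p * supNorm Ω f ^ p) ∧
    t = (∑ i, r i) / n}

/-- `f : 𝔻 → X` has the power-series expansion `f z = Σ_m a_m z^m`. -/
def RepresentsHolDisk (f : ℂ → X) (a : ℕ → X) : Prop :=
  ∀ z : ℂ, ‖z‖ < 1 → HasSum (fun m => z ^ m • a m) (f z)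

/-- The one-dimensional `λ`-powered Bohr radius `K_λ(𝔻, p, U)`. -/
def KradiusDisk (p lam : ℝ) (U : X →L[ℂ] Y) : ℝ :=
  sSup {r : ℝ | 0 ≤ r ∧ ∀ f a, RepresentsHolDisk f a → IsBoundedOnDisk f →
    ∀ F : Finset ℕ, ∑ m ∈ F, ‖U (a m)‖ ^ p * r ^ ((m : ℝ) * p) ≤ lam ^ p * supNormDisk f ^ p}

end Holomorphic

/-- `X` has cotype `t ∈ [2, ∞)`. -/
def HasCotype (X : Type*) [NormedAddCommGroup X] (t : ℝ) : Prop :=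
  ∃ C : ℝ, 0 < C ∧ ∀ (m : ℕ) (x : Fin m → X),
    (∑ k, ‖x k‖ ^ t) ^ (1 / t) ≤
      C * Real.sqrt ((2 ^ m : ℝ)⁻¹ * ∑ ε : Fin m → Bool, ‖∑ k, (if ε k then x k else -x k)‖ ^ 2)

/-- `Cot(X) = inf {t ∈ [2, ∞] : X has cotype t}` (every space has cotype `∞`). -/
def cotype (X : Type*) [NormedAddCommGroup X] : ℝ≥0∞ :=
  sInf {t : ℝ≥0∞ | 2 ≤ t ∧ (t ≠ ∞ → HasCotype X t.toReal)}

/-- `X` has cotype `t ∈ [2, ∞]` (extended-real exponent; cotype `∞` always holds). -/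
def HasCotypeE (X : Type*) [NormedAddCommGroup X] (t : ℝ≥0∞) : Prop :=
  t = ∞ ∨ HasCotype X t.toReal

/-- The constant `D` of Theorem 1.1 / Theorem `thm-1.8-atm`. -/
def Dconst (p lam u : ℝ) : ℝ :=
  if (4 * lam * (2 : ℝ) ^ (1 / p))⁻¹ ≤ u then
    max ((4 * lam * (2 : ℝ) ^ (1 / p))⁻¹ * ((lam ^ p - u ^ p) / (2 * lam ^ p - u ^ p)) ^ (1 / p))
      ((4 * lam * (2 : ℝ) ^ (1 / p))⁻¹ *
        ((lam ^ p - u ^ p) / (lam ^ p - u ^ p + 1)) ^ (1 / p) * u⁻¹)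
  else
    max ((4 * lam * (2 : ℝ) ^ (1 / p))⁻¹ * ((lam ^ p - u ^ p) / (2 * lam ^ p - u ^ p)) ^ (1 / p))
      ((4 * lam * (2 : ℝ) ^ (1 / p))⁻¹ * ((lam ^ p - u ^ p) / (lam ^ p - u ^ p + 1)) ^ (1 / p))

end ArithBohr

namespace ArithBohr


section torus
open MeasureTheory UnitAddTorus

local instance torMS : MeasureSpace UnitAddCircle := ⟨AddCircle.haarAddCircle⟩
local instance torHaar : Measure.IsAddHaarMeasure (volume : Measure UnitAddCircle) :=
  inferInstanceAs (Measure.IsAddHaarMeasure AddCircle.haarAddCircle)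
local instance torProb : IsProbabilityMeasure (volume : Measure UnitAddCircle) :=
  inferInstanceAs (IsProbabilityMeasure AddCircle.haarAddCircle)

theorem torus_functional (n : ℕ) (j : Fin n → ℤ) :
    ∃ T : C(UnitAddTorus (Fin n), ℂ) →L[ℂ] ℂ, (∀ h M, 0 ≤ M → (∀ x, ‖h x‖ ≤ M) → ‖T h‖ ≤ M) ∧
      ∀ k, T (mFourier k) = if k = j then 1 else 0 := by
  classical
  let A := (innerSL ℂ (mFourierLp (d := Fin n) 2 j)).comp
    (ContinuousMap.toLp (E := ℂ) 2 (volume : Measure (UnitAddTorus (Fin n))) ℂ)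
  refine ⟨A, ?_, ?_⟩
  · intro h M hM hh
    have h1 : ‖h‖ ≤ M := (ContinuousMap.norm_le _ hM).2 hh
    have h2 : ‖A h‖ ≤ ‖mFourierLp (d := Fin n) 2 j‖ * 
      ‖ContinuousMap.toLp (E := ℂ) 2 (volume : Measure (UnitAddTorus (Fin n))) ℂ h‖ :=
      norm_inner_le_norm (𝕜 := ℂ) (mFourierLp (d := Fin n) 2 j)
        (ContinuousMap.toLp (E := ℂ) 2 (volume : Measure (UnitAddTorus (Fin n))) ℂ h)
    rw [(orthonormal_mFourier (d := Fin n)).1 j, one_mul] at h2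
    have h3 : ‖ContinuousMap.toLp (E := ℂ) 2 (volume : Measure (UnitAddTorus (Fin n))) ℂ‖ ≤ 1 := by
      refine (ContinuousMap.toLp_norm_le (𝕜 := ℂ) _).trans ?_
      simp [measureUnivNNReal]
    have h4 := (ContinuousMap.toLp (E := ℂ) 2 (volume : Measure (UnitAddTorus (Fin n))) ℂ).le_of_opNorm_le h3 h
    linarith
  · intro k
    have := orthonormal_iff_ite.1 (orthonormal_mFourier (d := Fin n)) j k
    simp only [eq_comm (a := j)] at this
    exact this

end torus

open UnitAddTorus in
theorem fourier_aux {n : ℕ} (c d : (Fin n → ℕ) → ℂ) (hc : Summable c) (hd : Summable d)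
    (hd0 : d 0 = 0) (M : ℝ) (hM : 0 ≤ M)
    (h : ∀ x : UnitAddTorus (Fin n), ‖(∑' α, c α * mFourier (fun i => (α i : ℤ)) x) +
      ∑' α, d α * mFourier (fun i => -(α i : ℤ)) x‖ ≤ M) (β : Fin n → ℕ) :
    ‖c β‖ ≤ M ∧ ‖d β‖ ≤ M := by
  classical
  have key : ∀ (g : (Fin n → ℕ) → ℂ) (k : (Fin n → ℕ) → (Fin n → ℤ)), Summable g →
      Summable (fun α => g α • mFourier (k α)) := by
    intro g k hg
    refine Summable.of_norm ?_
    simpa [norm_smul, mFourier_norm] using hg.norm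
  have hC := key c (fun α i => (α i : ℤ)) hc
  have hD := key d (fun α i => -(α i : ℤ)) hd
  have hev : ∀ x, ‖((∑' α, c α • mFourier (fun i => (α i : ℤ))) +
      ∑' α, d α • mFourier (fun i => -(α i : ℤ)) : C(UnitAddTorus (Fin n), ℂ)) x‖ ≤ M := by
    intro x
    rw [ContinuousMap.add_apply, ← ContinuousMap.tsum_apply hC, ← ContinuousMap.tsum_apply hD]
    simpa using h x
  constructor
  · obtain ⟨T, h1, h2⟩ := torus_functional n (fun i => (β i : ℤ))
    have h3 := h1 _ M hM hev
    rw [map_add, T.map_tsum hC, T.map_tsum hD] at h3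
    simp only [map_smul, h2] at h3
    rw [tsum_eq_single β, tsum_eq_single 0] at h3
    · simpa [hd0] using h3
    · intro α hα
      rw [if_neg]; · simp
      intro h; apply hα; funext i; have := congrFun h i; simp; omega
    · intro α hα
      rw [if_neg]; · simp
      intro h; apply hα; funext i; have := congrFun h i; simpa using this
  · by_cases hβ : β = 0
    · simpa [hβ, hd0] using hM
    obtain ⟨T, h1, h2⟩ := torus_functional n (fun i => -(β i : ℤ))
    have h3 := h1 _ M hM hev
    rw [map_add, T.map_tsum hC, T.map_tsum hD] at h3
    simp only [map_smul, h2] at h3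
    rw [tsum_eq_single β (f := fun α => d α • _), tsum_congr (β := Fin n → ℕ) (g := fun _ => (0:ℂ)) (f := fun α => c α • _), tsum_zero] at h3
    · simpa [hd0] using h3
    · intro α
      rw [if_neg]; · simp
      intro h; apply hβ; funext i; have := congrFun h i; simp; omega
    · intro α hα
      rw [if_neg]; · simp
      intro h; apply hα; funext i; have := congrFun h i; simpa using this

theorem lqBall_torus {n : ℕ} {q : ℝ≥0∞} {z : Fin n → ℂ} (hz : z ∈ lqBall n q) (w : Fin n → ℂ)
    (hw : ∀ i, ‖w i‖ = ‖z i‖) : w ∈ lqBall n q := by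
  simp only [lqBall, lqNorm, Set.mem_ofPred_eq, hw] at *
  exact hz

section coef
variable {n : ℕ} {H : Type*} [NormedAddCommGroup H] [InnerProductSpace ℂ H] [CompleteSpace H]

theorem le_supNorm {Ω : Set (Fin n → ℂ)} {f : (Fin n → ℂ) → (H →L[ℂ] H)}
    (hf : IsBoundedOn Ω f) {z} (hz : z ∈ Ω) : ‖f z‖ ≤ supNorm Ω f := by
  obtain ⟨M, hM⟩ := hf
  exact le_ciSup (f := fun z : Ω => ‖f z.1‖) ⟨M, by rintro _ ⟨z, rfl⟩; exact hM _ z.2⟩ ⟨z, hz⟩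

theorem mono_fourier (z : Fin n → ℂ) (α : Fin n → ℕ) (x : UnitAddTorus (Fin n)) :
    mono (fun i => z i * fourier 1 (x i)) α =
      mono z α * UnitAddTorus.mFourier (fun i => (α i : ℤ)) x := by
  simp only [mono, UnitAddTorus.mFourier, ContinuousMap.coe_mk, mul_pow, Finset.prod_mul_distrib]
  congr 1
  refine Finset.prod_congr rfl fun i _ => ?_
  simp [fourier_apply, AddCircle.toCircle_nsmul]

theorem mono_star (z : Fin n → ℂ) (α : Fin n → ℕ) :
    mono (star z) α = starRingEnd ℂ (mono z α) := by
  simp [mono]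

theorem coef_bound {q : ℝ≥0∞} {f : (Fin n → ℂ) → (H →L[ℂ] H)} {a b}
    (h : ClsPH (lqBall n q) f a b) {z : Fin n → ℂ} (hz : z ∈ lqBall n q) (β : Fin n → ℕ) :
    ‖mono z β‖ * ‖a β‖ ≤ supNorm (lqBall n q) f ∧ ‖mono z β‖ * ‖b β‖ ≤ supNorm (lqBall n q) f := by
  have hM : 0 ≤ supNorm (lqBall n q) f := (norm_nonneg _).trans (le_supNorm h.2 hz)
  have main : ∀ φ : StrongDual ℂ (H →L[ℂ] H), ‖φ‖ ≤ 1 →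
      ‖φ (mono z β • a β)‖ ≤ supNorm (lqBall n q) f ∧
      ‖φ (mono (star z) β • ContinuousLinearMap.adjoint (b β))‖ ≤ supNorm (lqBall n q) f := by
    intro φ hφ
    refine fourier_aux (fun α => φ (mono z α • a α))
      (fun α => φ (mono (star z) α • ContinuousLinearMap.adjoint (b α))) ?_ ?_ ?_ _ hM ?_ β
    · exact φ.summable (h.1.2 z hz).1
    · exact φ.summable (h.1.2 z hz).2.1
    · simp [h.1.1]
    · intro x
      have hw : (fun i => z i * fourier 1 (x i)) ∈ lqBall n q :=
        lqBall_torus hz _ (by intro i; rw [norm_mul, fourier_apply, Circle.norm_coe, mul_one])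
      obtain ⟨s1, s2, e⟩ := h.1.2 _ hw
      have h1 := le_supNorm h.2 hw
      have h2 : ‖φ (f fun i => z i * fourier 1 (x i))‖ ≤ supNorm (lqBall n q) f :=
        (φ.le_of_opNorm_le hφ _).trans (by simpa using h1)
      rw [e, map_add, φ.map_tsum s1, φ.map_tsum s2] at h2
      refine le_trans (le_of_eq ?_) h2
      congr 2
      · refine tsum_congr fun α => ?_
        simp only [map_smul, mono_fourier, smul_eq_mul]; ring
      · refine tsum_congr fun α => ?_
        have : (fun i => -(α i : ℤ)) = -(fun i => ((α i : ℕ) : ℤ)) := rfl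
        rw [this]
        simp only [map_smul, mono_star, mono_fourier, smul_eq_mul, map_mul, UnitAddTorus.mFourier_neg]
        ring
  constructor
  · obtain ⟨φ, h1, h2⟩ := exists_dual_vector'' ℂ (mono z β • a β)
    have := (main φ h1).1
    rw [h2] at this
    simpa [norm_smul] using this
  · obtain ⟨φ, h1, h2⟩ := exists_dual_vector'' ℂ (mono (star z) β • ContinuousLinearMap.adjoint (b β))
    have := (main φ h1).2
    rw [h2] at this
    simpa [norm_smul, mono_star] using this
end coef

section proj
variable {H : Type*} [NormedAddCommGroup H] [InnerProductSpace ℂ H] [CompleteSpace H]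

theorem exists_proj (hH : ¬ FiniteDimensional ℂ H) (n : ℕ) :
    ∃ P : Fin n → (H →L[ℂ] H), (∀ i, ‖P i‖ = 1) ∧
      ∀ z : Fin n → ℂ, (∀ i, ‖z i‖ ≤ 1) → ‖∑ i, z i • P i‖ ≤ 1 := by
  have hr : (n : Cardinal) ≤ Module.rank ℂ H := by
    by_contra hlt
    apply hH
    exact Module.rank_lt_aleph0_iff.1 ((not_le.1 hlt).trans Cardinal.natCast_lt_aleph0)
  obtain ⟨v, hv⟩ := exists_linearIndependent_of_le_rank hr
  have he := InnerProductSpace.gramSchmidtNormed_orthonormal hv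
  set e := InnerProductSpace.gramSchmidtNormed ℂ v
  refine ⟨fun i => (innerSL ℂ (e i)).smulRight (e i), ?_, ?_⟩
  · intro i
    simp [ContinuousLinearMap.norm_smulRight_apply, he.1 i]
  · intro z hz
    refine ContinuousLinearMap.opNorm_le_bound _ zero_le_one fun x => ?_
    rw [one_mul]
    have h1 : (∑ i, z i • (innerSL ℂ (e i)).smulRight (e i)) x = ∑ i, (z i * inner ℂ (e i) x) • e i := by
      simp [smul_smul]
    rw [h1]
    have h2 : ‖∑ i, (z i * inner ℂ (e i) x) • e i‖ ^ 2 = ∑ i, ‖z i * inner ℂ (e i) x‖ ^ 2 := by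
      have := he.inner_sum (fun i => z i * inner ℂ (e i) x) (fun i => z i * inner ℂ (e i) x) Finset.univ
      rw [inner_self_eq_norm_sq_to_K] at this
      have h3 : ∀ w : ℂ, (starRingEnd ℂ) w * w = ((‖w‖ ^ 2 : ℝ) : ℂ) := by
        intro w; rw [mul_comm, Complex.mul_conj, Complex.normSq_eq_norm_sq]
      simp only [h3] at this
      apply Complex.ofReal_injective
      refine Eq.trans ?_ (this.trans ?_)
      · push_cast; rfl
      · push_cast; rfl
    refine le_of_sq_le_sq ?_ (norm_nonneg x)
    rw [h2]
    refine le_trans (Finset.sum_le_sum fun i _ => ?_) (he.sum_inner_products_le (s := Finset.univ) x)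
    rw [norm_mul]
    have := mul_le_mul_of_nonneg_right (hz i) (norm_nonneg (inner ℂ (e i) x))
    rw [one_mul] at this
    gcongr

theorem not_hasCotype (hH : ¬ FiniteDimensional ℂ H) (t : ℝ) (ht : 2 ≤ t) :
    ¬ HasCotype (H →L[ℂ] H) t := by
  rintro ⟨C, hC, h⟩
  obtain ⟨m, hm⟩ := exists_nat_gt (C ^ t)
  obtain ⟨P, h1, h2⟩ := exists_proj hH m
  have h3 := h m P
  have h4 : (2 ^ m : ℝ)⁻¹ * ∑ ε : Fin m → Bool, ‖∑ k, (if ε k then P k else -P k)‖ ^ 2 ≤ 1 := by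
    have : ∑ ε : Fin m → Bool, ‖∑ k, (if ε k then P k else -P k)‖ ^ 2 ≤ ∑ ε : Fin m → Bool, (1:ℝ) := by
      refine Finset.sum_le_sum fun ε _ => ?_
      have h5 := h2 (fun k => if ε k then 1 else -1) (by intro i; split_ifs <;> simp)
      have h6 : ∑ k, (if ε k then P k else -P k) = ∑ k, (if ε k then (1:ℂ) else -1) • P k := by
        refine Finset.sum_congr rfl fun k _ => ?_
        split_ifs <;> simp
      rw [h6]
      exact pow_le_one₀ (norm_nonneg _) h5
    simp only [Finset.sum_const, Finset.card_univ, Fintype.card_fun, Fintype.card_bool, Fintype.card_fin, nsmul_eq_mul, mul_one] at this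
    rw [inv_mul_le_iff₀ (by positivity)]
    simpa using this
  have h7 := Real.sqrt_le_one.2 h4
  simp only [h1, Real.one_rpow] at h3
  simp at h3
  have h8 : (m : ℝ) ^ (t⁻¹) ≤ C := by
    refine h3.trans ?_
    simpa using mul_le_mul_of_nonneg_left h7 hC.le
  have h9 : ((m : ℝ) ^ (t⁻¹)) ^ t ≤ C ^ t := Real.rpow_le_rpow (by positivity) h8 (by linarith)
  rw [Real.rpow_inv_rpow (by positivity) (by linarith)] at h9
  linarith

theorem cotype_top (hH : ¬ FiniteDimensional ℂ H) : cotype (H →L[ℂ] H) = ∞ := by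
  rw [cotype, sInf_eq_top]
  rintro t ⟨h1, h2⟩
  by_contra h
  refine not_hasCotype hH t.toReal ?_ (h2 h)
  exact (ENNReal.ofReal_le_iff_le_toReal h).1 (by simpa using h1)

theorem norm_le_lqNorm {n : ℕ} {q : ℝ≥0∞} (hq : 1 ≤ q) (z : Fin n → ℂ) (i : Fin n) :
    ‖z i‖ ≤ lqNorm q z := by
  unfold lqNorm
  split_ifs with h
  · exact le_ciSup (f := fun i => ‖z i‖) (Set.finite_range _).bddAbove i
  · have hq' : 1 ≤ q.toReal := by
      exact (ENNReal.ofReal_le_iff_le_toReal h).1 (by simpa using hq)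
    have h1 : ‖z i‖ ^ q.toReal ≤ ∑ i, ‖z i‖ ^ q.toReal :=
      Finset.single_le_sum (f := fun i => ‖z i‖ ^ q.toReal) (fun _ _ => by positivity) (Finset.mem_univ i)
    have h2 := Real.rpow_le_rpow (by positivity) h1 (show 0 ≤ 1 / q.toReal by positivity)
    rwa [one_div, Real.rpow_rpow_inv (norm_nonneg _) (by linarith), ← one_div] at h2

theorem goodVec_le (hH : ¬ FiniteDimensional ℂ H) (p : ℝ) (hp : 1 ≤ p) {q : ℝ≥0∞} (hq : 1 ≤ q)
    (lam : ℝ) (hlam : 1 < lam) (n : ℕ) (hn : 0 < n) (r : Fin n → ℝ) (hr : ∀ i, 0 ≤ r i)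
    (hg : GoodVec (lqBall n q) p lam (ContinuousLinearMap.id ℂ (H →L[ℂ] H)) (ClsPH (lqBall n q)) r) :
    (∑ i, r i) / n ≤ lam * (n : ℝ) ^ (-(1 / p)) := by
  classical
  obtain ⟨P, h1, h2⟩ := exists_proj hH n
  let s : Fin n → (Fin n → ℕ) := fun i => Pi.single i 1
  have hs : Function.Injective s := by
    intro i j hij
    by_contra hne
    have := congrFun hij i
    simp [s, hne] at this
  let a : (Fin n → ℕ) → (H →L[ℂ] H) := Function.extend s P 0
  have has : ∀ i, a (s i) = P i := fun i => hs.extend_apply _ _ _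
  have ha0 : ∀ α, α ∉ Set.range s → a α = 0 := fun α hα => by
    simp only [a]; rw [Function.extend_apply' _ _ _ (by simpa using hα)]; rfl
  have hmono : ∀ (z : Fin n → ℂ) i, mono z (s i) = z i := by
    intro z i
    simp only [mono, s]
    rw [Finset.prod_eq_single i]
    · simp
    · intro j _ hj; simp [hj]
    · simp
  have hmonoR : ∀ i, monoR r (s i) = r i := by
    intro i
    simp only [monoR, s]
    rw [Finset.prod_eq_single i]
    · simp
    · intro j _ hj; simp [hj]
    · simp
  have hsum : ∀ z : Fin n → ℂ, HasSum (fun α => mono z α • a α) (∑ i, z i • P i) := by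
    intro z
    have : HasSum ((fun α => mono z α • a α) ∘ s) (∑ i, z i • P i) := by
      have e : ((fun α => mono z α • a α) ∘ s) = fun i => z i • P i := by
        funext i; simp [hmono, has]
      rw [e]; exact hasSum_fintype _
    exact (hs.hasSum_iff (fun α hα => by simp [ha0 α hα])).1 this
  have hb : ∀ z ∈ lqBall n q, ‖∑ i, z i • P i‖ ≤ 1 := fun z hz =>
    h2 z fun i => (norm_le_lqNorm hq z i).trans (le_of_lt hz)
  have hcls : ClsPH (lqBall n q) (fun z => ∑ i, z i • P i) a (fun _ => 0) := by
    refine ⟨⟨rfl, fun z hz => ⟨(hsum z).summable, ?_, ?_⟩⟩, 1, hb⟩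
    · simp
    · simp [(hsum z).tsum_eq]
  have h3 := hg _ _ _ hcls (Finset.univ.map ⟨s, hs⟩)
  have h4 : supNorm (lqBall n q) (fun z => ∑ i, z i • P i) ≤ 1 :=
    Real.iSup_le (fun z => hb z.1 z.2) zero_le_one
  have h5 : 0 ≤ supNorm (lqBall n q) (fun z => ∑ i, z i • P i) :=
    Real.iSup_nonneg fun z => norm_nonneg _
  have hp0 : 0 < p := by linarith
  simp only [Finset.sum_map, Function.Embedding.coeFn_mk, has, hmonoR, ContinuousLinearMap.id_apply,
    h1, norm_zero, Real.one_rpow, Real.zero_rpow hp0.ne', add_zero, one_mul] at h3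
  have h6 : ∑ i, r i ^ p ≤ lam ^ p := by
    refine h3.trans ?_
    have := mul_le_mul_of_nonneg_left (Real.rpow_le_one h5 h4 hp0.le) (show 0 ≤ lam ^ p by positivity)
    simpa using this
  have hn0 : (0:ℝ) < n := by exact_mod_cast hn
  have h7 := Real.arith_mean_le_rpow_mean Finset.univ (fun _ : Fin n => (1 / n : ℝ)) r
    (fun _ _ => by positivity) (by simp [hn0.ne']) (fun i _ => hr i) hp
  rw [← Finset.mul_sum, ← Finset.mul_sum] at h7
  calc (∑ i, r i) / n = 1 / n * ∑ i, r i := by ring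
    _ ≤ _ := h7
    _ ≤ (1 / n * lam ^ p) ^ (1 / p) := by
      have : 0 ≤ ∑ i, r i ^ p := Finset.sum_nonneg fun i _ => Real.rpow_nonneg (hr i) p
      gcongr
    _ = lam * (n : ℝ) ^ (-(1 / p)) := by
      rw [Real.mul_rpow (by positivity) (by positivity), one_div p, Real.rpow_rpow_inv (by positivity) hp0.ne',
        Real.rpow_neg hn0.le, one_div, Real.inv_rpow hn0.le, mul_comm]

end proj

section lower
open Filter Topology

theorem opt_bound {n : ℕ} {q : ℝ≥0∞} (hq : 1 ≤ q) (hqt : q ≠ ∞) (α : Fin n → ℕ)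
    (hα : 0 < ∑ i, α i) (A M : ℝ)
    (h : ∀ z ∈ lqBall n q, ‖mono z α‖ * A ≤ M) :
    (∏ i, (((α i : ℝ) / (∑ i, α i : ℕ)) ^ (1 / q.toReal)) ^ α i) * A ≤ M := by
  have hQ : 1 ≤ q.toReal := (ENNReal.ofReal_le_iff_le_toReal hqt).1 (by simpa using hq)
  set Q := q.toReal
  set m := ∑ i, α i with hm
  have hm0 : (0:ℝ) < m := by exact_mod_cast hα
  set V := ∏ i, (((α i : ℝ) / m) ^ (1 / Q)) ^ α i with hV
  have h1 : ∀ ρ : ℝ, ρ ∈ Set.Ioo (0:ℝ) 1 → ρ ^ m * V * A ≤ M := by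
    intro ρ hρ
    have hnz : ∀ i, ‖((ρ * ((α i : ℝ) / m) ^ (1 / Q) : ℝ) : ℂ)‖ = ρ * ((α i : ℝ) / m) ^ (1 / Q) := by
      intro i
      rw [Complex.norm_real, Real.norm_of_nonneg]
      have := hρ.1
      positivity
    have h2 := h (fun i => ((ρ * ((α i : ℝ) / m) ^ (1 / Q) : ℝ) : ℂ)) (by
      show lqNorm q _ < 1
      rw [lqNorm, if_neg hqt]
      have : ∑ i, ‖((ρ * ((α i : ℝ) / m) ^ (1 / Q) : ℝ) : ℂ)‖ ^ Q = ρ ^ Q := by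
        have : ∀ i, ‖((ρ * ((α i : ℝ) / m) ^ (1 / Q) : ℝ) : ℂ)‖ ^ Q = ρ ^ Q * ((α i : ℝ) / m) := by
          intro i
          rw [hnz, Real.mul_rpow hρ.1.le (by positivity), one_div, Real.rpow_inv_rpow (by positivity) (by linarith)]
        simp only [this]
        rw [← Finset.mul_sum, ← Finset.sum_div, ← Nat.cast_sum, ← hm, div_self hm0.ne', mul_one]
      rw [this, one_div, Real.rpow_rpow_inv hρ.1.le (by linarith)]
      exact hρ.2)
    have h3 : ‖mono (fun i => ((ρ * ((α i : ℝ) / m) ^ (1 / Q) : ℝ) : ℂ)) α‖ = ρ ^ m * V := by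
      simp only [mono, norm_prod, norm_pow, hnz, mul_pow, Finset.prod_mul_distrib]
      rw [Finset.prod_pow_eq_pow_sum]
    rwa [h3] at h2
  have h4 : Tendsto (fun ρ : ℝ => ρ ^ m * V * A) (𝓝[<] 1) (𝓝 (1 ^ m * V * A)) :=
    Continuous.continuousWithinAt (by fun_prop)
  have h5 := le_of_tendsto h4 (by
    filter_upwards [Ioo_mem_nhdsLT (show (0:ℝ) < 1 by norm_num)] with ρ hρ using h1 ρ hρ)
  simpa using h5

theorem V_lower {n : ℕ} (α : Fin n → ℕ) (hα : 0 < ∑ i, α i) {Q : ℝ} (hQ : 1 ≤ Q) :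
    1 ≤ (∏ i, (((α i : ℝ) / (∑ i, α i : ℕ)) ^ (1 / Q)) ^ α i) *
      (Real.exp 1 ^ (∑ i, α i) * Nat.multinomial Finset.univ α) ^ (1 / Q) := by
  set m := ∑ i, α i with hm
  have hm0 : (0:ℝ) < m := by exact_mod_cast hα
  have e1 : (∏ i, (((α i : ℝ) / m) ^ (1 / Q)) ^ α i) = (∏ i, ((α i : ℝ) / m) ^ α i) ^ (1 / Q) := by
    rw [← Real.finsetProd_rpow _ _ (fun i _ => by positivity)]
    refine Finset.prod_congr rfl fun i _ => ?_
    rw [Real.rpow_pow_comm (by positivity)]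
  rw [e1, ← Real.mul_rpow (Finset.prod_nonneg fun i _ => by positivity) (by positivity)]
  refine Real.one_le_rpow ?_ (by positivity)
  have e2 : (∏ i, ((α i : ℝ) / m) ^ α i) = (∏ i, (α i : ℝ) ^ α i) / (m:ℝ) ^ m := by
    simp only [div_pow, Finset.prod_div_distrib]
    rw [Finset.prod_pow_eq_pow_sum]
  have e3 : (m : ℝ) ^ m ≤ Real.exp 1 ^ m * (m.factorial : ℝ) := by
    have := Real.pow_div_factorial_le_exp (m:ℝ) hm0.le m
    rw [div_le_iff₀ (by positivity)] at this
    rwa [← Real.exp_nat_mul, mul_one]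
  have e4 : ((m.factorial : ℕ) : ℝ) = (∏ i, ((α i).factorial : ℝ)) * Nat.multinomial Finset.univ α := by
    have := Nat.multinomial_spec Finset.univ α
    rw [← hm] at this
    rw [← this]; push_cast; rfl
  have e5 : (∏ i, ((α i).factorial : ℝ)) ≤ ∏ i, (α i : ℝ) ^ α i := by
    refine Finset.prod_le_prod (fun i _ => by positivity) fun i _ => ?_
    exact_mod_cast Nat.factorial_le_pow (α i)
  rw [e2, div_mul_eq_mul_div, le_div_iff₀ (by positivity), one_mul]
  calc (m:ℝ)^m ≤ _ := e3
    _ = (∏ i, ((α i).factorial : ℝ)) * (Real.exp 1 ^ m * Nat.multinomial Finset.univ α) := by rw [e4]; ring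
    _ ≤ _ := by gcongr

theorem sum_multinomial (n m : ℕ) (hn : 0 < n) :
    ∑ α ∈ Finset.piAntidiag (Finset.univ : Finset (Fin n)) m,
      (Nat.multinomial Finset.univ α : ℝ) / (n:ℝ) ^ m = 1 := by
  have := Finset.sum_pow_eq_sum_piAntidiag (Finset.univ : Finset (Fin n)) (fun _ => (1:ℝ)) m
  simp at this
  have hn0 : (0:ℝ) < n := by exact_mod_cast hn
  rw [← Finset.sum_div, ← this, div_self (by positivity)]

theorem coef_final {n : ℕ} (hn : 0 < n) {q : ℝ≥0∞} (hq : 1 ≤ q) (hqt : q ≠ ∞) {p : ℝ}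
    (hpq : q.toReal ≤ p) {x : ℝ} (hx : 0 ≤ x)
    (α : Fin n → ℕ) (hα : 0 < ∑ i, α i) (A M : ℝ) (hA : 0 ≤ A) (hM : 0 ≤ M)
    (h : ∀ z ∈ lqBall n q, ‖mono z α‖ * A ≤ M) :
    A ^ p * monoR (fun _ : Fin n => x ^ (1 / p) * (Real.exp 1 * n) ^ (-(1 / q.toReal))) α ^ p ≤
      M ^ p * (x ^ (∑ i, α i) * (Nat.multinomial Finset.univ α / (n:ℝ) ^ (∑ i, α i))) := by
  have hQ : 1 ≤ q.toReal := (ENNReal.ofReal_le_iff_le_toReal hqt).1 (by simpa using hq)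
  have h1 := opt_bound hq hqt α hα A M h
  have h2 := V_lower α hα hQ
  have h0 := sum_multinomial n (∑ i, α i) hn
  set Q := q.toReal
  set m := ∑ i, α i with hm
  have hn0 : (0:ℝ) < n := by exact_mod_cast hn
  set V := ∏ i, (((α i : ℝ) / m) ^ (1 / Q)) ^ α i with hV
  set μ : ℝ := (Nat.multinomial Finset.univ α : ℝ)
  have hμ : 0 ≤ μ := by positivity
  have hp0 : 0 < p := by linarith
  have hw1 : μ / (n:ℝ) ^ m ≤ 1 := by
    rw [← h0]
    exact Finset.single_le_sum (f := fun α => (Nat.multinomial Finset.univ α : ℝ) / (n:ℝ) ^ m)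
      (fun _ _ => by positivity) (by simp [hm])
  have hA2 : A ≤ M * (Real.exp 1 ^ m * μ) ^ (1 / Q) := by
    have : A * 1 ≤ A * (V * (Real.exp 1 ^ m * μ) ^ (1 / Q)) := mul_le_mul_of_nonneg_left h2 hA
    calc A ≤ A * (V * (Real.exp 1 ^ m * μ) ^ (1 / Q)) := by linarith
      _ = (V * A) * (Real.exp 1 ^ m * μ) ^ (1 / Q) := by ring
      _ ≤ _ := by gcongr
  have hmr : monoR (fun _ : Fin n => x ^ (1 / p) * (Real.exp 1 * n) ^ (-(1 / Q))) α =
      (x ^ m) ^ (1 / p) * ((Real.exp 1 ^ m * n ^ m)⁻¹) ^ (1 / Q) := by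
    simp only [monoR]
    rw [Finset.prod_pow_eq_pow_sum, ← hm, mul_pow, Real.rpow_pow_comm hx, Real.rpow_pow_comm (by positivity),
      Real.rpow_neg (by positivity), Real.inv_rpow (by positivity), mul_pow]
  have hkey : A * monoR (fun _ : Fin n => x ^ (1 / p) * (Real.exp 1 * n) ^ (-(1 / Q))) α ≤
      M * ((x ^ m) ^ (1 / p) * (μ / (n:ℝ) ^ m) ^ (1 / Q)) := by
    rw [hmr]
    calc _ ≤ (M * (Real.exp 1 ^ m * μ) ^ (1 / Q)) * ((x ^ m) ^ (1 / p) * ((Real.exp 1 ^ m * n ^ m)⁻¹) ^ (1 / Q)) := by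
          gcongr
      _ = M * ((x ^ m) ^ (1 / p) * ((Real.exp 1 ^ m * μ) ^ (1 / Q) * ((Real.exp 1 ^ m * n ^ m)⁻¹) ^ (1 / Q))) := by ring
      _ = _ := by
          rw [← Real.mul_rpow (by positivity) (by positivity)]
          congr 3
          field_simp
  have hmr0 : 0 ≤ monoR (fun _ : Fin n => x ^ (1 / p) * (Real.exp 1 * n) ^ (-(1 / Q))) α := by
    rw [hmr]; positivity
  rw [← Real.mul_rpow hA hmr0]
  refine (Real.rpow_le_rpow (by positivity) hkey hp0.le).trans ?_
  rw [Real.mul_rpow hM (by positivity), Real.mul_rpow (by positivity) (by positivity), one_div p,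
    Real.rpow_inv_rpow (by positivity) hp0.ne', ← Real.rpow_mul (by positivity)]
  have hle : (μ / (n:ℝ) ^ m) ^ (1 / Q * p) ≤ μ / (n:ℝ) ^ m := by
    rcases (show 0 ≤ μ / (n:ℝ) ^ m by positivity).eq_or_lt with h | h
    · rw [← h, Real.zero_rpow]; positivity
    · have h3 : 1 ≤ 1 / Q * p := by
        rw [one_div, inv_mul_eq_div, le_div_iff₀ (by linarith)]; linarith
      simpa using Real.rpow_le_rpow_of_exponent_ge h hw1 h3
  gcongr

theorem geom_bound {x : ℝ} (hx : 0 ≤ x) (hx1 : x < 1) (N : ℕ) :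
    ∑ m ∈ Finset.range N, (if m = 0 then 1 else 2 * x ^ m) ≤ (1 + x) / (1 - x) := by
  have h : ∀ N : ℕ, ∑ m ∈ Finset.range (N + 1), (if m = 0 then 1 else 2 * x ^ m) =
      (1 + x - 2 * x ^ (N + 1)) / (1 - x) := by
    intro N
    have : 1 - x ≠ 0 := by linarith
    induction N with
    | zero => simp; field_simp; ring
    | succ k ih => rw [Finset.sum_range_succ, ih, if_neg (by omega)]; field_simp; ring
  have h1 : 0 < 1 - x := by linarith
  cases N with
  | zero => simp; positivity
  | succ k =>
    rw [h]
    gcongr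
    have : 0 ≤ x ^ (k+1) := by positivity
    linarith

variable {H : Type*} [NormedAddCommGroup H] [InnerProductSpace ℂ H] [CompleteSpace H]

theorem good_vec {n : ℕ} (hn : 0 < n) {q : ℝ≥0∞} (hq : 1 ≤ q) (hqt : q ≠ ∞) {p : ℝ}
    (hpq : q.toReal ≤ p) {x : ℝ} (hx : 0 ≤ x) (hx1 : x < 1) {lam : ℝ}
    (hlam : (1 + x) / (1 - x) ≤ lam ^ p) :
    GoodVec (lqBall n q) p lam (ContinuousLinearMap.id ℂ (H →L[ℂ] H)) (ClsPH (lqBall n q))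
      (fun _ : Fin n => x ^ (1 / p) * (Real.exp 1 * n) ^ (-(1 / q.toReal))) := by
  classical
  intro f a b hf F
  have hQ : 1 ≤ q.toReal := (ENNReal.ofReal_le_iff_le_toReal hqt).1 (by simpa using hq)
  have hp0 : 0 < p := by linarith
  set r := (fun _ : Fin n => x ^ (1 / p) * (Real.exp 1 * n) ^ (-(1 / q.toReal)))
  set M := supNorm (lqBall n q) f
  have hM : 0 ≤ M := Real.iSup_nonneg fun z => norm_nonneg _
  let T : (Fin n → ℕ) → ℝ := fun α => (‖a α‖ ^ p + ‖b α‖ ^ p) * monoR r α ^ p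
  let w : (Fin n → ℕ) → ℝ := fun α => Nat.multinomial Finset.univ α / (n:ℝ) ^ (∑ i, α i)
  let c : ℕ → ℝ := fun m => if m = 0 then 1 else 2 * x ^ m
  have hc : ∀ m, 0 ≤ c m := by intro m; simp only [c]; split_ifs <;> positivity
  have hw : ∀ α, 0 ≤ w α := fun α => by positivity
  have hT : ∀ α, T α ≤ M ^ p * (c (∑ i, α i) * w α) := by
    intro α
    rcases Nat.eq_zero_or_pos (∑ i, α i) with h0 | hpos
    · have hα : α = 0 := by
        funext i; simpa using (Finset.sum_eq_zero_iff.1 h0) i (Finset.mem_univ i)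
      subst hα
      have hz : (0 : Fin n → ℂ) ∈ lqBall n q := by
        show lqNorm q _ < 1
        rw [lqNorm, if_neg hqt]
        simp [Real.zero_rpow (show q.toReal ≠ 0 by linarith), Real.zero_rpow (show q.toReal⁻¹ ≠ 0 by positivity)]
      have h1 := (coef_bound hf hz 0).1
      have h2 : ‖a 0‖ ≤ M := by simpa [mono] using h1
      have h3 : w 0 = 1 := by simp [w, Nat.multinomial]
      simp only [T, hf.1.1, h3]
      simp only [c, monoR]
      simp [Real.zero_rpow hp0.ne']
      gcongr
    · have h1 := coef_final hn hq hqt hpq hx α hpos ‖a α‖ M (norm_nonneg _) hM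
        (fun z hz => (coef_bound hf hz α).1)
      have h2 := coef_final hn hq hqt hpq hx α hpos ‖b α‖ M (norm_nonneg _) hM
        (fun z hz => (coef_bound hf hz α).2)
      simp only [T, c, if_neg hpos.ne', w]
      rw [add_mul]
      calc _ ≤ _ := add_le_add h1 h2
        _ = _ := by ring
  obtain ⟨N, hN⟩ : ∃ N, ∀ α ∈ F, ∑ i, α i ∈ Finset.range N := by
    refine ⟨F.sup (fun α => ∑ i, α i) + 1, fun α hα => ?_⟩
    rw [Finset.mem_range, Nat.lt_succ_iff]
    exact Finset.le_sup (f := fun α : Fin n → ℕ => ∑ i, α i) hα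
  show ∑ α ∈ F, T α ≤ _
  rw [← Finset.sum_fiberwise_of_maps_to hN]
  calc ∑ m ∈ Finset.range N, ∑ α ∈ F with ∑ i, α i = m, T α
      ≤ ∑ m ∈ Finset.range N, M ^ p * c m := by
        refine Finset.sum_le_sum fun m _ => ?_
        calc ∑ α ∈ F with ∑ i, α i = m, T α
            ≤ ∑ α ∈ F with ∑ i, α i = m, M ^ p * c m * (Nat.multinomial Finset.univ α / (n:ℝ) ^ m) := by
              refine Finset.sum_le_sum fun α hα => ?_
              have h1 := hT α
              simp only [w, (Finset.mem_filter.1 hα).2] at h1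
              linarith
          _ ≤ ∑ α ∈ Finset.piAntidiag Finset.univ m, M ^ p * c m * (Nat.multinomial Finset.univ α / (n:ℝ) ^ m) := by
              refine Finset.sum_le_sum_of_subset_of_nonneg ?_ ?_
              · intro α hα
                simpa using (Finset.mem_filter.1 hα).2
              · intro α _ _
                have := hc m
                positivity
          _ = M ^ p * c m := by rw [← Finset.mul_sum, sum_multinomial n m hn, mul_one]
    _ = M ^ p * ∑ m ∈ Finset.range N, c m := by rw [Finset.mul_sum]
    _ ≤ M ^ p * lam ^ p := by
        gcongr
        exact (geom_bound hx hx1 N).trans hlam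
    _ = _ := mul_comm _ _

end lower

end ArithBohr

namespace ArithBohr

universe u

/-- Theorem `thm-1.3-atm`: asymptotic estimates for
`AP_λ(B_{ℓ^n_q}, p, X)` when `X = B(H)` is infinite dimensional, in terms of `Cot(X)`. -/
theorem statement9 (p : ℝ) (hp : 1 ≤ p) (q : ℝ≥0∞) (hq : 1 ≤ q) :
    ∃ E₅ : ℝ, 0 < E₅ ∧ ∃ E₆ : ℝ, 0 < E₆ ∧
      ∀ (H : Type u) [NormedAddCommGroup H] [InnerProductSpace ℂ H] [CompleteSpace H],
        ¬ FiniteDimensional ℂ H →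
        ∀ lam : ℝ, 1 < lam → ∀ n : ℕ, 0 < n →
          (min (cotype (H →L[ℂ] H)) q < ENNReal.ofReal p →
            E₅ * ((lam ^ p - 1) ^ (1 / p) / lam) * (n : ℝ) ^ (-(q⁻¹.toReal)) ≤
              APradius (lqBall n q) p lam (ContinuousLinearMap.id ℂ (H →L[ℂ] H))) ∧
          (ENNReal.ofReal p ≤ min (cotype (H →L[ℂ] H)) q →
            ∀ t : ℝ, 2 ≤ t → HasCotype (H →L[ℂ] H) t →
              E₆ * ((lam ^ p - 1) ^ (1 / p) / lam) *
                  (n : ℝ) ^ ((min (ENNReal.ofReal t) q)⁻¹.toReal - 1 / p - q⁻¹.toReal) ≤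
                APradius (lqBall n q) p lam (ContinuousLinearMap.id ℂ (H →L[ℂ] H))) ∧
          (q ≤ cotype (H →L[ℂ] H) →
            APradius (lqBall n q) p lam (ContinuousLinearMap.id ℂ (H →L[ℂ] H)) ≤
              2 ^ (1 - 1 / p) * lam * (n : ℝ) ^ (-(1 / p))) ∧
          (cotype (H →L[ℂ] H) < q →
            APradius (lqBall n q) p lam (ContinuousLinearMap.id ℂ (H →L[ℂ] H)) ≤
              2 ^ (1 - 1 / p) * lam *
                (n : ℝ) ^ ((cotype (H →L[ℂ] H))⁻¹.toReal - 1 / p - q⁻¹.toReal)) := by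
  refine ⟨(2:ℝ) ^ (-(1 / p)) * Real.exp 1 ^ (-(1 / q.toReal)), by positivity, 1, one_pos, ?_⟩
  intro H _ _ _ hH lam hlam n hn
  have hct := cotype_top hH
  have hn0 : (0:ℝ) < n := by exact_mod_cast hn
  have hp0 : 0 < p := by linarith
  refine ⟨?_, ?_, ?_, ?_⟩
  · intro h
    rw [hct, min_eq_right le_top] at h
    have hqt : q ≠ ∞ := ne_top_of_lt h
    have hpq : q.toReal ≤ p := by
      refine ENNReal.toReal_le_of_le_ofReal hp0.le h.le
    have hL : 1 < lam ^ p := Real.one_lt_rpow hlam hp0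
    set L := lam ^ p with hLdef
    set x := (L - 1) / (2 * L) with hxdef
    have hx : 0 ≤ x := div_nonneg (by linarith) (by linarith)
    have hx1 : x < 1 := by rw [hxdef, div_lt_one (by linarith)]; linarith
    have hxl : (1 + x) / (1 - x) ≤ L := by
      rw [div_le_iff₀ (by linarith)]
      have hxL : x * (2 * L) = L - 1 := by rw [hxdef]; field_simp
      nlinarith [sq_nonneg (L - 1)]
    have hg := good_vec (H := H) hn hq hqt hpq hx hx1 hxl
    refine le_csSup ?_ ⟨_, ?_, hg, ?_⟩
    · refine ⟨lam * (n : ℝ) ^ (-(1 / p)), ?_⟩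
      rintro t ⟨r, hr, hr2, rfl⟩
      exact goodVec_le hH p hp hq lam hlam n hn r hr hr2
    · intro i; positivity
    · have e1 : x ^ (1 / p) = (L - 1) ^ (1 / p) / (2 ^ (1 / p) * lam) := by
        rw [hxdef, Real.div_rpow (by linarith) (by linarith), Real.mul_rpow (by norm_num) (by linarith), hLdef,
          one_div p, Real.rpow_rpow_inv (by linarith) hp0.ne']
      rw [Finset.sum_const, Finset.card_univ, Fintype.card_fin, nsmul_eq_mul, mul_div_cancel_left₀ _ hn0.ne', e1,
        Real.mul_rpow (by positivity) hn0.le, ENNReal.toReal_inv, Real.rpow_neg (by norm_num : (0:ℝ) ≤ 2), one_div q.toReal]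
      field_simp
  · intro _ t ht h
    exact absurd h (not_hasCotype hH t ht)
  · intro _
    have h2 : (1:ℝ) ≤ 2 ^ (1 - 1 / p) := by
      refine Real.one_le_rpow (by norm_num) ?_
      rw [sub_nonneg, div_le_one hp0]; exact hp
    refine Real.sSup_le ?_ (by positivity)
    rintro t ⟨r, hr, hr2, rfl⟩
    refine (goodVec_le hH p hp hq lam hlam n hn r hr hr2).trans ?_
    have h3 : 0 ≤ lam * (n : ℝ) ^ (-(1 / p)) := by positivity
    rw [mul_assoc]
    nlinarith
  · intro h
    rw [hct] at h
    exact absurd h (not_lt.2 le_top)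

end ArithBohr
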